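/- For all real numbers r, r′, β with 0 ≤ r′ < r, one has r² − 2rr′cos β + r′² > 0 and the series ∑_{n=0}^∞ (r′ⁿ / r^{n+1})·Pₙ(cos β) converges to 1/√(r² − 2rr′cos β + r′²). -/

import Mathlib

/-- The Legendre polynomials (as functions `ℝ → ℝ`), defined by the recurrence
`P₀(t) = 1`, `P₁(t) = t`, `(n+1)·P_{n+1}(t) = (2n+1)·t·Pₙ(t) − n·P_{n−1}(t)`. -/
noncomputable def legendreP : ℕ → ℝ → ℝ
  | 0, _ => 1
  | 1, t => t
  | (n + 2), t =>
      ((2 * (n + 1 : ℝ) + 1) * t * legendreP (n + 1) t - (n + 1 : ℝ) * legendreP n t)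
        / ((n + 1 : ℝ) + 1)

theorem legendreP_succ_succ (n : ℕ) (t : ℝ) :
    ((n : ℝ) + 2) * legendreP (n + 2) t =
      (2 * n + 3) * t * legendreP (n + 1) t - (n + 1) * legendreP n t := by
  rw [legendreP]
  have : (n : ℝ) + 1 + 1 ≠ 0 := by positivity
  field_simp
  ring

/-- The quadratic form in two consecutive Legendre polynomials that is nonincreasing in the degree
is bounded by its initial value. -/
theorem legendreP_energy_le (n : ℕ) (t : ℝ) :
    (legendreP (n + 1) t - t * legendreP n t) ^ 2 + (1 - t ^ 2) * legendreP n t ^ 2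
      ≤ 1 - t ^ 2 := by
  induction n with
  | zero => simp [legendreP]
  | succ n ih =>
    have hrec := legendreP_succ_succ n t
    set a := legendreP n t
    set b := legendreP (n + 1) t
    have hn : (0 : ℝ) < n + 2 := by positivity
    have hc : legendreP (n + 1 + 1) t - t * b = (1 - 1 / ((n : ℝ) + 2)) * (t * b - a) := by
      have : legendreP (n + 1 + 1) t = ((2 * n + 3) * t * b - (n + 1) * a) / ((n : ℝ) + 2) := by
        rw [eq_div_iff hn.ne', ← hrec]; ring
      rw [this]
      field_simp
      ring
    rw [hc, mul_pow]
    have h0 : 0 ≤ 1 - 1 / ((n : ℝ) + 2) := by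
      rw [sub_nonneg, div_le_one hn]; linarith [(Nat.cast_nonneg n : (0 : ℝ) ≤ n)]
    have h1 : 1 - 1 / ((n : ℝ) + 2) ≤ 1 := by
      have : 0 < 1 / ((n : ℝ) + 2) := by positivity
      linarith
    have h2 := mul_le_mul_of_nonneg_right (pow_le_one₀ (n := 2) h0 h1) (sq_nonneg (t * b - a))
    nlinarith

theorem legendreP_eq_pow {t : ℝ} (ht : t ^ 2 = 1) (n : ℕ) : legendreP n t = t ^ n := by
  induction n using Nat.strong_induction_on with
  | _ n ih =>
    match n with
    | 0 => simp [legendreP]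
    | 1 => simp [legendreP]
    | n + 2 =>
      have h := legendreP_succ_succ n t
      rw [ih (n + 1) (by lia), ih n (by lia)] at h
      have hn : (n : ℝ) + 2 ≠ 0 := by positivity
      apply mul_left_cancel₀ hn
      rw [h, pow_add t n 2, ht]
      linear_combination (2 * n + 3) * t ^ n * ht

theorem abs_legendreP_le_one {t : ℝ} (ht : |t| ≤ 1) (n : ℕ) : |legendreP n t| ≤ 1 := by
  have ht2 : t ^ 2 ≤ 1 := (sq_le_one_iff_abs_le_one t).2 ht
  rcases ht2.eq_or_lt with h | h
  · rw [legendreP_eq_pow h, abs_pow]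
    exact pow_le_one₀ (abs_nonneg t) ht
  · rw [← sq_le_one_iff_abs_le_one]
    have h1 := legendreP_energy_le n t
    have h2 := sq_nonneg (legendreP (n + 1) t - t * legendreP n t)
    nlinarith

theorem one_sub_two_mul_add_sq_pos {t x : ℝ} (ht : |t| ≤ 1) (hx : |x| < 1) :
    0 < 1 - 2 * t * x + x ^ 2 := by
  obtain ⟨h1, h2⟩ := abs_le.1 ht
  have hx2 : x ^ 2 < 1 := (sq_lt_one_iff_abs_lt_one x).2 hx
  obtain ⟨h3, h4⟩ := abs_lt.1 hx
  have ha : 0 < (1 - x) ^ 2 := pow_pos (by linarith) 2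
  have hb : 0 < (1 + x) ^ 2 := pow_pos (by linarith) 2
  rcases le_total 0 t with h | h
  · nlinarith [mul_nonneg (by linarith : 0 ≤ 1 - t) hb.le]
  · nlinarith [mul_nonneg (by linarith : 0 ≤ 1 + t) ha.le]

theorem summable_legendreP_mul_pow {t x : ℝ} (ht : |t| ≤ 1) (hx : |x| < 1) :
    Summable fun n : ℕ => legendreP n t * x ^ n := by
  refine Summable.of_norm_bounded (summable_geometric_of_abs_lt_one (r := |x|) (by simpa)) ?_
  intro n
  rw [norm_mul, norm_pow]
  exact mul_le_of_le_one_left (by positivity) (abs_legendreP_le_one ht n)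

theorem summable_nat_mul_pow_pred {ρ : ℝ} (hρ : |ρ| < 1) :
    Summable fun n : ℕ => (n : ℝ) * ρ ^ (n - 1) := by
  rw [← summable_nat_add_iff 1]
  have h1 := summable_pow_mul_geometric_of_norm_lt_one 1 (r := ρ) hρ
  have h2 := summable_geometric_of_abs_lt_one hρ
  refine (h1.add h2).congr fun n => ?_
  push_cast
  simp
  ring

theorem summable_legendreP_mul_deriv_pow {t x : ℝ} (ht : |t| ≤ 1) (hx : |x| < 1) :
    Summable fun n : ℕ => legendreP n t * (n * x ^ (n - 1)) := by
  refine Summable.of_norm_bounded (summable_nat_mul_pow_pred (ρ := |x|) (by simpa)) ?_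
  intro n
  rw [norm_mul, norm_mul, norm_pow, Real.norm_natCast]
  exact mul_le_of_le_one_left (by positivity) (abs_legendreP_le_one ht n)

theorem hasDerivAt_tsum_legendreP {t x : ℝ} (ht : |t| ≤ 1) (hx : |x| < 1) :
    HasDerivAt (fun y => ∑' n : ℕ, legendreP n t * y ^ n)
      (∑' n : ℕ, legendreP n t * (n * x ^ (n - 1))) x := by
  obtain ⟨ρ, hxρ, hρ⟩ := exists_between hx
  have hρ0 : 0 < ρ := (abs_nonneg x).trans_lt hxρ
  refine hasDerivAt_tsum_of_isPreconnected (u := fun n : ℕ => (n : ℝ) * ρ ^ (n - 1))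
    (t := Set.Ioo (-ρ) ρ) (y₀ := 0) (summable_nat_mul_pow_pred (by rwa [abs_of_pos hρ0]))
    isOpen_Ioo isPreconnected_Ioo (fun n y _ => (hasDerivAt_pow n y).const_mul _) ?_
    ⟨by linarith, hρ0⟩ (summable_legendreP_mul_pow ht (by simp)) (abs_lt.1 hxρ)
  intro n y hy
  rw [norm_mul, norm_mul, norm_pow, Real.norm_natCast]
  have hy' : ‖y‖ ≤ ρ := (abs_lt.2 hy).le
  calc ‖legendreP n t‖ * (n * ‖y‖ ^ (n - 1)) ≤ n * ‖y‖ ^ (n - 1) :=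
        mul_le_of_le_one_left (by positivity) (abs_legendreP_le_one ht n)
    _ ≤ n * ρ ^ (n - 1) := by gcongr

/-- The differential equation of the generating function. -/
theorem tsum_legendreP_ode {t x : ℝ} (ht : |t| ≤ 1) (hx : |x| < 1) :
    (1 - 2 * t * x + x ^ 2) * ∑' n : ℕ, legendreP n t * (n * x ^ (n - 1)) =
      (t - x) * ∑' n : ℕ, legendreP n t * x ^ n := by
  have hA := (summable_legendreP_mul_pow ht hx).hasSum
  have hD := (summable_legendreP_mul_deriv_pow ht hx).hasSum
  set A := ∑' n : ℕ, legendreP n t * x ^ n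
  set D := ∑' n : ℕ, legendreP n t * (n * x ^ (n - 1))
  have hA1 := (hasSum_nat_add_iff' 1).2 hA
  have hD1 := (hasSum_nat_add_iff' 1).2 hD
  have hD2 := (hasSum_nat_add_iff' 2).2 hD
  have hR := (((hD1.mul_left (2 * t * x)).add (hA1.mul_left t)).sub (hD.mul_left (x ^ 2))).sub
    (hA.mul_left x)
  have hterm : ∀ n : ℕ, legendreP (n + 2) t * ((n + 2 : ℕ) * x ^ (n + 2 - 1)) =
      2 * t * x * (legendreP (n + 1) t * ((n + 1 : ℕ) * x ^ (n + 1 - 1))) +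
        t * (legendreP (n + 1) t * x ^ (n + 1)) -
        x ^ 2 * (legendreP n t * (n * x ^ (n - 1))) - x * (legendreP n t * x ^ n) := by
    intro n
    have hrec := legendreP_succ_succ n t
    have hpow : x ^ 2 * (legendreP n t * (n * x ^ (n - 1))) =
        legendreP n t * n * x ^ (n + 1) := by
      cases n with
      | zero => simp
      | succ m => simp; ring
    rw [hpow]
    rw [show n + 2 - 1 = n + 1 by lia, Nat.add_sub_cancel]
    push_cast
    linear_combination x ^ (n + 1) * hrec
  have hsum := hD2.unique (hR.congr_fun hterm)
  simp [Finset.sum_range_succ, legendreP] at hsum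
  linear_combination hsum

/-- The generating function of the Legendre polynomials. -/
theorem hasSum_legendreP_mul_pow {t x : ℝ} (ht : |t| ≤ 1) (hx : |x| < 1) :
    HasSum (fun n : ℕ => legendreP n t * x ^ n) (1 / √(1 - 2 * t * x + x ^ 2)) := by
  set A : ℝ → ℝ := fun y => ∑' n : ℕ, legendreP n t * y ^ n with hAdef
  have hderiv : ∀ y ∈ Set.Ioo (-1 : ℝ) 1,
      HasDerivAt (fun y => A y * √(1 - 2 * t * y + y ^ 2)) 0 y := by
    intro y hy
    have hy' : |y| < 1 := abs_lt.2 hy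
    have hq := one_sub_two_mul_add_sq_pos ht hy'
    have hq' : HasDerivAt (fun y : ℝ => 1 - 2 * t * y + y ^ 2) (-(2 * t) + 2 * y) y := by
      have h := (((hasDerivAt_id' y).const_mul (2 * t)).const_sub 1).fun_add (hasDerivAt_pow 2 y)
      simpa using h
    refine ((hasDerivAt_tsum_legendreP ht hy').fun_mul (hq'.sqrt hq.ne')).congr_deriv ?_
    have hode := tsum_legendreP_ode ht hy'
    have hs : 0 < √(1 - 2 * t * y + y ^ 2) := Real.sqrt_pos.2 hq
    have hs2 := Real.sq_sqrt hq.le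
    generalize (∑' n : ℕ, legendreP n t * (n * y ^ (n - 1))) = D at hode ⊢
    field_simp
    rw [hs2]
    linear_combination hode
  have hconst : A x * √(1 - 2 * t * x + x ^ 2) = A 0 * √(1 - 2 * t * 0 + 0 ^ 2) :=
    isOpen_Ioo.is_const_of_deriv_eq_zero isPreconnected_Ioo
      (fun y hy => (hderiv y hy).differentiableAt.differentiableWithinAt)
      (fun y hy => (hderiv y hy).deriv) (abs_lt.1 hx) (by norm_num)
  have hA0 : A 0 = 1 := by
    rw [hAdef]
    dsimp only
    rw [tsum_eq_single 0 (fun n hn => by simp [hn])]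
    simp [legendreP]
  have hs : 0 < √(1 - 2 * t * x + x ^ 2) := Real.sqrt_pos.2 (one_sub_two_mul_add_sq_pos ht hx)
  have hAx : A x = 1 / √(1 - 2 * t * x + x ^ 2) := by
    rw [eq_div_iff hs.ne', hconst, hA0]
    simp
  rw [← hAx]
  exact (summable_legendreP_mul_pow ht hx).hasSum

theorem legendre_gravitational_potential (r r' β : ℝ) (hr' : 0 ≤ r') (hrr : r' < r) :
    r ^ 2 - 2 * r * r' * Real.cos β + r' ^ 2 > 0 ∧
      HasSum (fun n : ℕ => r' ^ n / r ^ (n + 1) * legendreP n (Real.cos β))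
        (1 / Real.sqrt (r ^ 2 - 2 * r * r' * Real.cos β + r' ^ 2)) := by
  have hr : 0 < r := hr'.trans_lt hrr
  have ht := Real.abs_cos_le_one β
  have hx : |r' / r| < 1 := by
    rwa [abs_of_nonneg (by positivity), div_lt_one hr]
  have heq : r ^ 2 - 2 * r * r' * Real.cos β + r' ^ 2 =
      r ^ 2 * (1 - 2 * Real.cos β * (r' / r) + (r' / r) ^ 2) := by
    field_simp
  have hq := one_sub_two_mul_add_sq_pos ht hx
  rw [heq]
  refine ⟨by positivity, ?_⟩
  rw [Real.sqrt_mul (by positivity), Real.sqrt_sq hr.le, mul_comm r, ← div_div]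
  refine ((hasSum_legendreP_mul_pow ht hx).div_const r).congr_fun fun n => ?_
  rw [div_pow]
  field_simp
  ring
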